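/- Let α ∈ (0,1). Then Φ is integrable on (0,∞), and for every R > 1 one has the explicit bound ∫₁^R Φ(s) ds ≤ (2−α)(1+α) / (α(1−α)Γ(1−α)). -/

import Mathlib

open MeasureTheory Real Set
/-- The function `Φ(x) = Σ (−1)ⁿ bₙ (x^{1+α}/(1+α))ⁿ`, where
`bₙ = ∏_{i<n} Γ(αi+i+2)/Γ(α(i+1)+i+2)`; it equals the generalized Mittag-Leffler
function `E_{α,1+1/α,1/α}(−x^{1+α}/(1+α))`. -/
noncomputable def PhiF (α : ℝ) (x : ℝ) : ℝ :=
  ∑' n : ℕ, (-1:ℝ)^n *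
    (∏ i ∈ Finset.range n, Real.Gamma (α * i + i + 2) / Real.Gamma (α * (i+1) + i + 2)) *
    (x ^ (1+α) / (1+α)) ^ n

open Filter Topology

/-! ### The fractional kernel -/

/-- The Beta integral over `[0, a]`, for real exponents. -/
theorem integral_rpow_mul_sub_rpow {u v a : ℝ} (hu : 0 < u) (hv : 0 < v) (ha : 0 < a) :
    ∫ x in (0:ℝ)..a, x ^ (u - 1) * (a - x) ^ (v - 1) =
      a ^ (u + v - 1) * (Gamma u * Gamma v / Gamma (u + v)) := by
  have h := Complex.betaIntegral_scaled (u : ℂ) (v : ℂ) ha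
  rw [Complex.betaIntegral_eq_Gamma_mul_div _ _ (by simpa) (by simpa)] at h
  have e : ∫ x in (0:ℝ)..a, (x:ℂ) ^ ((u:ℂ) - 1) * ((a:ℂ) - x) ^ ((v:ℂ) - 1) =
      ∫ x in (0:ℝ)..a, ((x ^ (u - 1) * (a - x) ^ (v - 1) : ℝ) : ℂ) := by
    refine intervalIntegral.integral_congr fun x hx => ?_
    rw [uIcc_of_le ha.le] at hx
    rw [Complex.ofReal_mul, Complex.ofReal_cpow hx.1, Complex.ofReal_cpow (sub_nonneg.2 hx.2)]
    push_cast
    rfl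
  rw [e, intervalIntegral.integral_ofReal] at h
  apply Complex.ofReal_injective
  rw [h, Complex.ofReal_mul, Complex.ofReal_cpow ha.le, Complex.ofReal_div, Complex.ofReal_mul,
    ← Complex.Gamma_ofReal, ← Complex.Gamma_ofReal, ← Complex.Gamma_ofReal]
  push_cast
  rfl

theorem intervalIntegrable_sub_rpow_neg {α : ℝ} (hα : α < 1) (t a b : ℝ) :
    IntervalIntegrable (fun s => (t - s) ^ (-α)) volume a b := by
  have h := (intervalIntegral.intervalIntegrable_rpow' (a := t - a) (b := t - b)
    (r := -α) (by linarith)).comp_sub_left t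
  simpa using h

theorem integral_sub_rpow_neg {α : ℝ} (hα : α < 1) (x t : ℝ) :
    ∫ s in x..t, (t - s) ^ (-α) = (t - x) ^ (1 - α) / (1 - α) := by
  rw [intervalIntegral.integral_comp_sub_left (fun s => s ^ (-α)) t,
    integral_rpow (Or.inl (by linarith)), sub_self, zero_rpow (by linarith), sub_zero,
    neg_add_eq_sub]

/-- If `f ≥ 0` on `[0, t]` vanishes at `t` and is differentiable there, then the fractional
integral of `f` of order `1 - α` has nonpositive derivative at `t`. -/
theorem deriv_fracIntegral_nonpos {α t D : ℝ} {f : ℝ → ℝ} (hα₀ : 0 < α) (hα : α < 1) (ht : 0 < t)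
    (hf : Continuous f) (hft : f t = 0) (hf₀ : ∀ s ∈ Icc 0 t, 0 ≤ f s)
    (hfd : DifferentiableAt ℝ f t)
    (hD : HasDerivAt (fun x => ∫ s in (0:ℝ)..x, f s * (x - s) ^ (-α)) D t) : D ≤ 0 := by
  set F : ℝ → ℝ := fun x => ∫ s in (0:ℝ)..x, f s * (x - s) ^ (-α) with hF
  have hint : ∀ x a b, IntervalIntegrable (fun s => f s * (x - s) ^ (-α)) volume a b :=
    fun x a b => (intervalIntegrable_sub_rpow_neg hα x a b).continuousOn_mul hf.continuousOn
  obtain ⟨C, hC₀, hC⟩ := hfd.isBigO_sub.exists_pos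
  obtain ⟨δ, hδ, hCδ⟩ := Metric.eventually_nhds_iff.1 hC.bound
  have hslope : Tendsto (slope F t) (𝓝[<] t) (𝓝 D) :=
    (hasDerivWithinAt_iff_tendsto_slope' (by simp)).1 hD.hasDerivWithinAt
  have hpow : Tendsto (fun x => C * (t - x) ^ (1 - α) / (1 - α)) (𝓝[<] t) (𝓝 0) := by
    have : Continuous fun x => C * (t - x) ^ (1 - α) / (1 - α) :=
      (continuous_const.mul ((continuous_rpow_const (by linarith)).comp
        (continuous_const.sub continuous_id))).div_const _
    have h := (this.tendsto t).mono_left (nhdsWithin_le_nhds (s := Iio t))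
    simpa [zero_rpow (show 1 - α ≠ 0 by linarith)] using h
  refine le_of_tendsto_of_tendsto hslope hpow ?_
  have hmem : Ioo (max 0 (t - δ)) t ∈ 𝓝[<] t :=
    Ioo_mem_nhdsLT (max_lt ht (by linarith))
  filter_upwards [hmem] with x hx
  have hx₀ : 0 < x := (le_max_left _ _).trans_lt hx.1
  have hxδ : t - δ < x := (le_max_right _ _).trans_lt hx.1
  have hxt : x < t := hx.2
  have h₁ : ∫ s in (0:ℝ)..x, f s * (t - s) ^ (-α) ≤ F x := by
    refine intervalIntegral.integral_mono_on_of_le_Ioo hx₀.le (hint _ _ _) (hint _ _ _) ?_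
    intro s hs
    refine mul_le_mul_of_nonneg_left ?_ (hf₀ s ⟨hs.1.le, (hs.2.trans hxt).le⟩)
    exact rpow_le_rpow_of_nonpos (by linarith [hs.2]) (by linarith) (by linarith)
  have h₂ : ∫ s in x..t, f s * (t - s) ^ (-α) ≤ ∫ s in x..t, C * (t - x) * (t - s) ^ (-α) := by
    refine intervalIntegral.integral_mono_on_of_le_Ioo hxt.le (hint _ _ _)
      ((intervalIntegrable_sub_rpow_neg hα _ _ _).const_mul _) ?_
    intro s hs
    have hb := hCδ (y := s) (by rw [Real.dist_eq, abs_lt]; constructor <;> linarith [hs.1, hs.2])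
    rw [hft, sub_zero, Real.norm_eq_abs, Real.norm_eq_abs, abs_sub_comm s t,
      abs_of_pos (sub_pos.2 hs.2)] at hb
    refine mul_le_mul_of_nonneg_right ?_ (rpow_nonneg (by linarith [hs.2]) _)
    exact (le_abs_self _).trans (hb.trans (mul_le_mul_of_nonneg_left (by linarith [hs.1]) hC₀.le))
  rw [intervalIntegral.integral_const_mul, integral_sub_rpow_neg hα] at h₂
  have h₃ : F t = (∫ s in (0:ℝ)..x, f s * (t - s) ^ (-α)) + ∫ s in x..t, f s * (t - s) ^ (-α) :=
    (intervalIntegral.integral_add_adjacent_intervals (hint _ _ _) (hint _ _ _)).symm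
  have hpos : 0 < t - x := sub_pos.2 hxt
  rw [slope_comm, slope_def_field, div_le_iff₀ hpos]
  calc F t - F x ≤ C * (t - x) * ((t - x) ^ (1 - α) / (1 - α)) := by linarith
    _ = _ := by ring

/-! ### The power series -/

/-- The coefficients of `PhiF α` as a power series in `x ^ (1 + α)`. -/
noncomputable def phiCoeff (α : ℝ) (n : ℕ) : ℝ :=
  (-1) ^ n *
    (∏ i ∈ Finset.range n, Gamma (α * i + i + 2) / Gamma (α * (i + 1) + i + 2)) / (1 + α) ^ n

theorem PhiF_eq_tsum (α x : ℝ) : PhiF α x = ∑' n, phiCoeff α n * (x ^ (1 + α)) ^ n := by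
  unfold PhiF phiCoeff
  refine tsum_congr fun n => ?_
  rw [div_pow]
  ring

theorem phiCoeff_zero (α : ℝ) : phiCoeff α 0 = 1 := by simp [phiCoeff]

theorem phiCoeff_succ (α : ℝ) (n : ℕ) :
    phiCoeff α (n + 1) = -(phiCoeff α n *
      (Gamma (α * n + n + 2) / Gamma (α * (n + 1) + n + 2)) / (1 + α)) := by
  unfold phiCoeff
  rw [Finset.prod_range_succ, pow_succ, pow_succ, mul_div_assoc, mul_div_assoc, mul_div_assoc,
    ← div_div]
  ring

theorem phiCoeff_ne_zero {α : ℝ} (hα : α ∈ Ioo (0:ℝ) 1) (n : ℕ) : phiCoeff α n ≠ 0 := by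
  have h0 := hα.1
  unfold phiCoeff
  refine div_ne_zero (mul_ne_zero (by simp) (Finset.prod_ne_zero_iff.2 fun i _ => ?_))
    (by positivity)
  exact (div_pos (Gamma_pos_of_pos (by positivity)) (Gamma_pos_of_pos (by positivity))).ne'

theorem Gamma_div_Gamma_add_le {α : ℝ} (hα : α ∈ Ioo (0:ℝ) 1) {x : ℝ} (hx : 1 < x) :
    Gamma x / Gamma (x + α) ≤ (x + α - 1) ^ (-α) := by
  have h0 := hα.1
  have h1 := hα.2
  have hy : 0 < x + α - 1 := by linarith
  have hG := Gamma_pos_of_pos hy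
  have h := Gamma_mul_add_mul_le_rpow_Gamma_mul_rpow_Gamma hy (show 0 < x + α by linarith) h0
    (show 0 < 1 - α by linarith) (by ring)
  have e : Gamma (x + α) = (x + α - 1) * Gamma (x + α - 1) := by
    rw [← Gamma_add_one hy.ne']; congr 1; ring
  rw [show α * (x + α - 1) + (1 - α) * (x + α) = x by ring] at h
  rw [div_le_iff₀ (Gamma_pos_of_pos (by linarith))]
  refine h.trans_eq ?_
  rw [e, mul_rpow hy.le hG.le, mul_left_comm, ← rpow_add hG, rpow_sub hy, rpow_neg hy.le,
    add_sub_cancel, rpow_one, rpow_one]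
  ring

theorem tendsto_phiCoeff_ratio {α : ℝ} (hα : α ∈ Ioo (0:ℝ) 1) :
    Tendsto (fun n => ‖phiCoeff α (n + 1)‖ / ‖phiCoeff α n‖) atTop (𝓝 0) := by
  have h0 := hα.1
  have hlim : Tendsto (fun n : ℕ => (α * n + n + 2 + α - 1) ^ (-α)) atTop (𝓝 0) := by
    refine (tendsto_rpow_neg_atTop h0).comp ?_
    refine tendsto_atTop_mono (fun n => ?_) tendsto_natCast_atTop_atTop
    nlinarith [mul_nonneg h0.le n.cast_nonneg (α := ℝ)]
  refine squeeze_zero (fun n => by positivity) (fun n => ?_) hlim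
  have hn : 0 < α * n + n + 2 := by positivity
  have hr : 0 < Gamma (α * n + n + 2) / Gamma (α * n + n + 2 + α) :=
    div_pos (Gamma_pos_of_pos hn) (Gamma_pos_of_pos (by linarith))
  have hc : 0 < ‖phiCoeff α n‖ := norm_pos_iff.2 (phiCoeff_ne_zero hα n)
  rw [phiCoeff_succ, show α * ((n:ℝ) + 1) + n + 2 = α * n + n + 2 + α by ring, norm_neg, norm_div,
    norm_mul, Real.norm_of_nonneg hr.le, Real.norm_of_nonneg (by linarith : 0 ≤ 1 + α),
    mul_div_assoc, mul_div_cancel_left₀ _ hc.ne']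
  refine (div_le_self hr.le (by linarith)).trans (Gamma_div_Gamma_add_le hα ?_)
  have : 0 ≤ α * n := by positivity
  have : (0:ℝ) ≤ n := n.cast_nonneg
  linarith

theorem phiCoeff_radius {α : ℝ} (hα : α ∈ Ioo (0:ℝ) 1) :
    (FormalMultilinearSeries.ofScalars ℝ (phiCoeff α)).radius = ⊤ :=
  FormalMultilinearSeries.ofScalars_radius_eq_top_of_tendsto _ _
    (Eventually.of_forall (phiCoeff_ne_zero hα)) (tendsto_phiCoeff_ratio hα)

theorem hasFPowerSeriesOnBall_phiCoeff {α : ℝ} (hα : α ∈ Ioo (0:ℝ) 1) :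
    HasFPowerSeriesOnBall (fun y => ∑' n, phiCoeff α n * y ^ n)
      (FormalMultilinearSeries.ofScalars ℝ (phiCoeff α)) 0 ⊤ := by
  have h := (FormalMultilinearSeries.ofScalars ℝ (phiCoeff α)).hasFPowerSeriesOnBall
    (by simp [phiCoeff_radius hα])
  rw [phiCoeff_radius hα] at h
  convert h using 2 with y
  simp [FormalMultilinearSeries.sum, mul_comm]

theorem summable_norm_phiCoeff_mul_pow {α : ℝ} (hα : α ∈ Ioo (0:ℝ) 1) (y : ℝ) :
    Summable fun n => ‖phiCoeff α n * y ^ n‖ := by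
  have h := (FormalMultilinearSeries.ofScalars ℝ (phiCoeff α)).summable_norm_apply (x := y)
    (by simp [phiCoeff_radius hα])
  simpa [FormalMultilinearSeries.ofScalars_apply_eq, mul_comm] using h

theorem hasSum_PhiF {α : ℝ} (hα : α ∈ Ioo (0:ℝ) 1) (x : ℝ) :
    HasSum (fun n => phiCoeff α n * (x ^ (1 + α)) ^ n) (PhiF α x) := by
  rw [PhiF_eq_tsum]
  exact (summable_norm_phiCoeff_mul_pow hα _).of_norm.hasSum

theorem differentiable_PhiF {α : ℝ} (hα : α ∈ Ioo (0:ℝ) 1) : Differentiable ℝ (PhiF α) := by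
  have hg : Differentiable ℝ fun y : ℝ => ∑' n, phiCoeff α n * y ^ n := fun y =>
    (hasFPowerSeriesOnBall_phiCoeff hα).differentiableOn.differentiableAt (by simp)
  have h := hg.comp (Real.differentiable_rpow_const (p := 1 + α) (by linarith [hα.1]))
  rwa [show PhiF α = _ from funext (PhiF_eq_tsum α)]

theorem PhiF_zero {α : ℝ} (hα : α ∈ Ioo (0:ℝ) 1) : PhiF α 0 = 1 := by
  have h0 := hα.1
  rw [PhiF_eq_tsum, tsum_eq_single 0]
  · simp [phiCoeff_zero]
  · intro n hn
    simp [zero_rpow (show 1 + α ≠ 0 by linarith), hn]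

/-- Termwise integration of `PhiF α` against an integrable weight. -/
theorem hasSum_integral_PhiF_mul {α : ℝ} (hα : α ∈ Ioo (0:ℝ) 1) {w : ℝ → ℝ} {t : ℝ} (ht : 0 ≤ t)
    (hw : IntervalIntegrable w volume 0 t) :
    HasSum (fun n : ℕ => phiCoeff α n * ∫ s in (0:ℝ)..t, s ^ ((1 + α) * n) * w s)
      (∫ s in (0:ℝ)..t, PhiF α s * w s) := by
  have h0 := hα.1
  have key : HasSum (fun n : ℕ => ∫ s in (0:ℝ)..t, phiCoeff α n * (s ^ (1 + α)) ^ n * w s)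
      (∫ s in (0:ℝ)..t, PhiF α s * w s) := by
    refine intervalIntegral.hasSum_integral_of_dominated_convergence
      (fun n s => ‖phiCoeff α n * (t ^ (1 + α)) ^ n‖ * ‖w s‖) (fun n => ?_) (fun n => ?_) ?_ ?_ ?_
    · refine AEStronglyMeasurable.mul ?_ hw.def'.aestronglyMeasurable
      exact (continuous_const.mul
        ((continuous_rpow_const (by linarith)).pow n)).aestronglyMeasurable
    · refine Eventually.of_forall fun s hs => ?_
      rw [uIoc_of_le ht] at hs
      rw [norm_mul]
      refine mul_le_mul_of_nonneg_right ?_ (norm_nonneg _)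
      rw [norm_mul, norm_mul]
      refine mul_le_mul_of_nonneg_left ?_ (norm_nonneg _)
      rw [norm_of_nonneg (pow_nonneg (rpow_nonneg hs.1.le _) _),
        norm_of_nonneg (pow_nonneg (rpow_nonneg ht _) _)]
      exact pow_le_pow_left₀ (rpow_nonneg hs.1.le _) (rpow_le_rpow hs.1.le hs.2 (by linarith)) _
    · exact Eventually.of_forall fun s _ => (summable_norm_phiCoeff_mul_pow hα _).mul_right _
    · simp only [tsum_mul_right]
      exact hw.norm.const_mul _
    · exact Eventually.of_forall fun s _ => (hasSum_PhiF hα s).mul_right _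
  convert key using 2 with n
  rw [← intervalIntegral.integral_const_mul]
  refine intervalIntegral.integral_congr fun s hs => ?_
  rw [uIcc_of_le ht] at hs
  rw [rpow_mul hs.1, rpow_natCast, mul_assoc]

/-- The integrated fractional relaxation equation satisfied by `PhiF α`. -/
theorem fracIntegral_PhiF {α : ℝ} (hα : α ∈ Ioo (0:ℝ) 1) {t : ℝ} (ht : 0 < t) :
    ∫ s in (0:ℝ)..t, PhiF α s * (t - s) ^ (-α) =
      t ^ (1 - α) / (1 - α) - Gamma (1 - α) / (1 + α) * ∫ s in (0:ℝ)..t, PhiF α s * s := by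
  have h0 := hα.1
  have h1 := hα.2
  have hA := hasSum_integral_PhiF_mul hα ht.le (intervalIntegrable_sub_rpow_neg h1 t 0 t)
  have hB := hasSum_integral_PhiF_mul hα ht.le
    (continuous_id.intervalIntegrable (μ := volume) (0:ℝ) t)
  have hA' := (hasSum_nat_add_iff' 1).2 hA
  simp only [Finset.range_one, Finset.sum_singleton, phiCoeff_zero, Nat.cast_zero, mul_zero,
    rpow_zero, one_mul, integral_sub_rpow_neg h1, sub_zero, id] at hA' hB
  have hterm : ∀ n : ℕ, phiCoeff α (n + 1) *
      ∫ s in (0:ℝ)..t, s ^ ((1 + α) * ((n + 1 : ℕ) : ℝ)) * (t - s) ^ (-α) =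
      -(Gamma (1 - α) / (1 + α)) * (phiCoeff α n * ∫ s in (0:ℝ)..t, s ^ ((1 + α) * n) * s) := by
    intro n
    have hq : 0 < α * n + n + 2 := by positivity
    have e1 := integral_rpow_mul_sub_rpow (u := α * (n + 1) + n + 2) (v := 1 - α)
      (by positivity) (by linarith) ht
    have e2 : ∫ s in (0:ℝ)..t, s ^ ((1 + α) * n) * s =
        t ^ (α * n + n + 2) / (α * n + n + 2) := by
      have : ∀ s ∈ uIcc 0 t, s ^ ((1 + α) * n) * s = s ^ (α * n + n + 1) := by
        intro s hs
        rw [uIcc_of_le ht.le] at hs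
        rw [show α * n + n + 1 = (1 + α) * n + 1 by ring, rpow_add_one' hs.1 (by positivity)]
      rw [intervalIntegral.integral_congr this,
        integral_rpow (Or.inl (by linarith)), show α * n + n + 1 + 1 = α * n + n + 2 by ring,
        zero_rpow hq.ne', sub_zero]
    rw [show α * ((n:ℝ) + 1) + n + 2 - 1 = (1 + α) * ((n + 1 : ℕ) : ℝ) by push_cast; ring,
      show 1 - α - 1 = -α by ring,
      show α * ((n:ℝ) + 1) + n + 2 + (1 - α) = α * n + n + 2 + 1 by ring, Gamma_add_one hq.ne',
      show α * (n:ℝ) + n + 2 + 1 - 1 = α * n + n + 2 by ring] at e1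
    rw [e1, e2, phiCoeff_succ]
    have g1 : Gamma (α * (n + 1) + n + 2) ≠ 0 := (Gamma_pos_of_pos (by positivity)).ne'
    have g2 : Gamma (α * n + n + 2) ≠ 0 := (Gamma_pos_of_pos hq).ne'
    have g3 : 1 + α ≠ 0 := by linarith
    field_simp
  simp only [hterm] at hA'
  have := hA'.unique (hB.mul_left _)
  linarith

theorem PhiF_nonneg {α : ℝ} (hα : α ∈ Ioo (0:ℝ) 1) {x : ℝ} (hx : 0 ≤ x) : 0 ≤ PhiF α x := by
  have h0 := hα.1
  have h1 := hα.2
  have hd := differentiable_PhiF hα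
  have hcont := hd.continuous
  by_contra! hneg
  obtain ⟨t, ht, hmin⟩ := isCompact_Icc.exists_isMinOn (nonempty_Icc.2 hx) hcont.continuousOn
  set m := PhiF α t with hm
  have hm0 : m < 0 := (hmin (right_mem_Icc.2 hx)).trans_lt hneg
  have ht0 : 0 < t := by
    refine ht.1.lt_of_ne fun h => ?_
    rw [hm, ← h, PhiF_zero hα] at hm0
    linarith
  have hG : 0 < Gamma (1 - α) := Gamma_pos_of_pos (by linarith)
  have hderiv : HasDerivAt (fun x => (1 - m) * (x ^ (1 - α) / (1 - α)) -
      Gamma (1 - α) / (1 + α) * ∫ s in (0:ℝ)..x, PhiF α s * s)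
      ((1 - m) * t ^ (-α) - Gamma (1 - α) / (1 + α) * (m * t)) t := by
    have d1 := ((hasDerivAt_rpow_const (x := t) (p := 1 - α) (Or.inl ht0.ne')).div_const
      (1 - α)).const_mul (1 - m)
    have d2 := ((hcont.mul continuous_id).integral_hasStrictDerivAt 0 t).hasDerivAt.const_mul
      (Gamma (1 - α) / (1 + α))
    refine (d1.sub d2).congr_deriv ?_
    rw [show 1 - α - 1 = -α by ring, mul_div_cancel_left₀ _ (by linarith)]
    simp [hm]
  have hfrac : HasDerivAt (fun x => ∫ s in (0:ℝ)..x, (PhiF α s - m) * (x - s) ^ (-α))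
      ((1 - m) * t ^ (-α) - Gamma (1 - α) / (1 + α) * (m * t)) t := by
    refine hderiv.congr_of_eventuallyEq ?_
    filter_upwards [lt_mem_nhds ht0] with y hy
    have hk := intervalIntegrable_sub_rpow_neg h1 y 0 y
    simp only [sub_mul]
    rw [intervalIntegral.integral_sub (hk.continuousOn_mul hcont.continuousOn) (hk.const_mul _),
      intervalIntegral.integral_const_mul, integral_sub_rpow_neg h1, fracIntegral_PhiF hα hy,
      sub_zero]
    ring
  have hle := deriv_fracIntegral_nonpos h0 h1 ht0 (hcont.sub continuous_const) (by simp)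
    (fun s hs => sub_nonneg.2 (hmin ⟨hs.1, hs.2.trans ht.2⟩)) ((hd t).sub_const m) hfrac
  have p1 : 0 < (1 - m) * t ^ (-α) := mul_pos (by linarith) (rpow_pos_of_pos ht0 _)
  have p2 : Gamma (1 - α) / (1 + α) * (m * t) < 0 :=
    mul_neg_of_pos_of_neg (by positivity) (mul_neg_of_neg_of_pos hm0 ht0)
  linarith

theorem integral_PhiF_mul_self_le {α : ℝ} (hα : α ∈ Ioo (0:ℝ) 1) {t : ℝ} (ht : 0 < t) :
    ∫ s in (0:ℝ)..t, PhiF α s * s ≤ (1 + α) / ((1 - α) * Gamma (1 - α)) * t ^ (1 - α) := by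
  have h0 := hα.1
  have h1 : 0 < 1 - α := sub_pos.2 hα.2
  have hG : 0 < Gamma (1 - α) := Gamma_pos_of_pos h1
  have hn : 0 ≤ ∫ s in (0:ℝ)..t, PhiF α s * (t - s) ^ (-α) :=
    intervalIntegral.integral_nonneg ht.le fun s hs =>
      mul_nonneg (PhiF_nonneg hα hs.1) (rpow_nonneg (sub_nonneg.2 hs.2) _)
  rw [fracIntegral_PhiF hα ht, sub_nonneg, ← le_div_iff₀' (by positivity)] at hn
  refine hn.trans_eq ?_
  field_simp

theorem integral_PhiF_le {α : ℝ} (hα : α ∈ Ioo (0:ℝ) 1) {R : ℝ} (hR : 1 ≤ R) :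
    ∫ s in (1:ℝ)..R, PhiF α s ≤ (1 + α) / (α * (1 - α) * Gamma (1 - α)) := by
  have h0 := hα.1
  have h1 : 0 < 1 - α := sub_pos.2 hα.2
  have hG : 0 < Gamma (1 - α) := Gamma_pos_of_pos h1
  have hR0 : 0 < R := by linarith
  have hcont : Continuous fun s => PhiF α s * s :=
    (differentiable_PhiF hα).continuous.mul continuous_id
  set G : ℝ → ℝ := fun x => ∫ s in (0:ℝ)..x, PhiF α s * s with hGdef
  set K := (1 + α) / ((1 - α) * Gamma (1 - α)) with hK
  have hK0 : 0 < K := by positivity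
  have hGd : ∀ x, HasDerivAt G (PhiF α x * x) x := fun x =>
    (hcont.integral_hasStrictDerivAt 0 x).hasDerivAt
  have hGc : Continuous G := continuous_iff_continuousAt.2 fun x => (hGd x).continuousAt
  have hne : ∀ x ∈ uIcc 1 R, 0 < x := fun x hx => by
    rw [uIcc_of_le hR] at hx; linarith [hx.1]
  have hu' : ContinuousOn (fun x : ℝ => -(x ^ 2)⁻¹) (uIcc 1 R) :=
    ((continuousOn_id.pow 2).inv₀ fun x hx => (pow_pos (hne x hx) 2).ne').neg
  have parts := intervalIntegral.integral_mul_deriv_eq_deriv_mul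
    (fun x hx => hasDerivAt_inv (hne x hx).ne') (fun x _ => hGd x)
    hu'.intervalIntegrable (hcont.intervalIntegrable 1 R)
  have e : ∫ x in (1:ℝ)..R, x⁻¹ * (PhiF α x * x) = ∫ x in (1:ℝ)..R, PhiF α x := by
    refine intervalIntegral.integral_congr fun x hx => ?_
    have := (hne x hx).ne'
    field_simp
  have hG1 : 0 ≤ G 1 := intervalIntegral.integral_nonneg zero_le_one fun s hs =>
    mul_nonneg (PhiF_nonneg hα hs.1) hs.1
  have hGR : R⁻¹ * G R ≤ K * R ^ (-α) := by
    refine (mul_le_mul_of_nonneg_left (integral_PhiF_mul_self_le hα hR0)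
      (by positivity)).trans_eq ?_
    rw [← hK, sub_eq_neg_add, rpow_add_one hR0.ne', mul_left_comm, mul_comm (R ^ (-α)),
      inv_mul_cancel_left₀ hR0.ne']
  have hint : ∫ x in (1:ℝ)..R, (x ^ 2)⁻¹ * G x ≤ K * ((1 - R ^ (-α)) / α) := by
    have hb : ∫ x in (1:ℝ)..R, K * x ^ (-α - 1) = K * ((1 - R ^ (-α)) / α) := by
      rw [intervalIntegral.integral_const_mul, integral_rpow (Or.inr ⟨by linarith, fun h =>
        lt_irrefl _ (hne 0 h)⟩), one_rpow, sub_add_cancel, ← neg_div_neg_eq, neg_neg, neg_sub]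
    rw [← hb]
    refine intervalIntegral.integral_mono_on hR ?_ ?_ fun x hx => ?_
    · exact ((hu'.neg.congr fun x _ => (neg_neg _).symm).mul hGc.continuousOn).intervalIntegrable
    · refine ContinuousOn.intervalIntegrable fun x hx => ContinuousAt.continuousWithinAt ?_
      exact continuousAt_const.mul (continuousAt_rpow_const _ _ (Or.inl (hne x hx).ne'))
    · have hx0 : 0 < x := by linarith [hx.1]
      refine (mul_le_mul_of_nonneg_left (integral_PhiF_mul_self_le hα hx0)
        (by positivity)).trans_eq ?_
      rw [← hK, show -α - 1 = 1 - α - (2:ℕ) by push_cast; ring, rpow_sub hx0 (1 - α), rpow_natCast]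
      ring
  simp only [neg_mul, intervalIntegral.integral_neg] at parts
  rw [e] at parts
  have hRα : 0 ≤ R ^ (-α) := rpow_nonneg hR0.le _
  calc ∫ s in (1:ℝ)..R, PhiF α s ≤ K * R ^ (-α) + K * ((1 - R ^ (-α)) / α) := by
        rw [parts]; linarith
    _ = K / α - K * R ^ (-α) * ((1 - α) / α) := by field_simp; ring
    _ ≤ K / α := sub_le_self _ (by positivity)
    _ = _ := by rw [hK]; field_simp

/-- `Φ` is integrable on `(0,∞)` and
`∫₁^R Φ(s) ds ≤ (2−α)(1+α)/(α(1−α)Γ(1−α))` for every `R > 1`. -/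
theorem Phi_integrable (α : ℝ) (hα : α ∈ Set.Ioo (0:ℝ) 1) :
    IntegrableOn (PhiF α) (Set.Ioi 0) ∧
    ∀ R > (1:ℝ), ∫ s in (1:ℝ)..R, PhiF α s ≤
      (2 - α) * (1 + α) / (α * (1 - α) * Real.Gamma (1 - α)) := by
  have h0 := hα.1
  have h1 : 0 < 1 - α := sub_pos.2 hα.2
  have hG : 0 < Gamma (1 - α) := Gamma_pos_of_pos h1
  have hcont := (differentiable_PhiF hα).continuous
  constructor
  · rw [← Ioc_union_Ioi_eq_Ioi zero_le_one]
    refine hcont.integrableOn_Ioc.union ?_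
    refine integrableOn_Ioi_of_intervalIntegral_norm_bounded
      ((1 + α) / (α * (1 - α) * Gamma (1 - α))) 1
      (fun R => hcont.integrableOn_Ioc) tendsto_id ?_
    filter_upwards [eventually_ge_atTop 1] with R hR
    have e : ∫ x in (1:ℝ)..R, ‖PhiF α x‖ = ∫ x in (1:ℝ)..R, PhiF α x := by
      refine intervalIntegral.integral_congr fun x hx => ?_
      rw [uIcc_of_le hR] at hx
      exact norm_of_nonneg (PhiF_nonneg hα (by linarith [hx.1]))
    exact e.trans_le (integral_PhiF_le hα hR)
  · intro R hR
    refine (integral_PhiF_le hα hR.le).trans (div_le_div_of_nonneg_right ?_ (by positivity))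
    nlinarith
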